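/- Let g'(e, k) denote the number of simple connected graphs with e edges on k labeled vertices. For every k ≥ 1, the alternating sum ∑_{e=0}^{C(k,2)} (-1)^e g'(e,k) equals (-1)^{k+1} (k-1)!. -/

import Mathlib

/-- Number of connected simple graphs with `e` edges on `k` labeled vertices. -/
noncomputable def gconn (e k : ℕ) : ℕ :=
  Nat.card {G : SimpleGraph (Fin k) // G.Connected ∧ Nat.card G.edgeSet = e}

open Classical in
/-- Signed sum over connected graphs. -/
noncomputable def fconn (V : Type) [Fintype V] : ℤ :=
  ∑ G : SimpleGraph V with G.Connected, (-1 : ℤ) ^ (Nat.card G.edgeSet)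

lemma sign_sup {V : Type} [Fintype V] (G : SimpleGraph V) (a b : V) (hab : a ≠ b)
    (h : ¬ G.Adj a b) :
    (-1 : ℤ) ^ (Nat.card (G ⊔ SimpleGraph.edge a b).edgeSet) =
      - (-1 : ℤ) ^ (Nat.card G.edgeSet) := by
  classical
  have := G.card_edgeFinset_sup_edge h hab
  simp only [← SimpleGraph.coe_edgeFinset, Nat.card_eq_card_toFinset, Finset.toFinset_coe]
  rw [this, pow_succ]; ring

/-- Toggle an edge. -/
noncomputable def tog {V : Type} (a b : V) (G : SimpleGraph V) : SimpleGraph V :=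
  symmDiff G (SimpleGraph.edge a b)

lemma tog_tog {V : Type} (a b : V) (G : SimpleGraph V) : tog a b (tog a b G) = G := by
  simp [tog, symmDiff_symmDiff_cancel_right]

lemma tog_adj {V : Type} (a b : V) (hab : a ≠ b) (G : SimpleGraph V) :
    (tog a b G).Adj a b ↔ ¬ G.Adj a b := by
  simp [tog, symmDiff, SimpleGraph.edge_adj, hab]

lemma tog_eq {V : Type} (a b : V) (hab : a ≠ b) (G : SimpleGraph V) (h : ¬ G.Adj a b) :
    tog a b G = G ⊔ SimpleGraph.edge a b := by
  have : Disjoint G (SimpleGraph.edge a b) := by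
    rw [SimpleGraph.disjoint_edge]; exact h
  exact this.symmDiff_eq_sup

lemma sign_tog {V : Type} [Fintype V] (G : SimpleGraph V) (a b : V) (hab : a ≠ b) :
    (-1 : ℤ) ^ (Nat.card (tog a b G).edgeSet) = - (-1 : ℤ) ^ (Nat.card G.edgeSet) := by
  by_cases h : G.Adj a b
  · have h' : ¬ (tog a b G).Adj a b := by rw [tog_adj a b hab]; simpa using h
    have := sign_sup (tog a b G) a b hab h'
    rw [← tog_eq a b hab _ h', tog_tog] at this
    rw [this]; ring
  · rw [tog_eq a b hab G h, sign_sup G a b hab h]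

lemma tog_reach_aux {V : Type} (G : SimpleGraph V) (v a b : V)
    (ha : ¬ G.Reachable v a) (hb : ¬ G.Reachable v b) (x : V) (h : G.Reachable v x) :
    (tog a b G).Reachable v x := by
  rw [SimpleGraph.reachable_iff_reflTransGen] at h
  induction h with
  | refl => exact SimpleGraph.Reachable.refl _
  | @tail y z hy hyz ih =>
    rw [← SimpleGraph.reachable_iff_reflTransGen] at hy
    refine ih.trans (SimpleGraph.Adj.reachable ?_)
    have h1 : y ≠ a := by rintro rfl; exact ha hy
    have h2 : y ≠ b := by rintro rfl; exact hb hy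
    simp [tog, symmDiff, SimpleGraph.edge_adj, hyz, h1, h2]

lemma tog_reach_aux2 {V : Type} (G : SimpleGraph V) (v a b : V)
    (ha : ¬ G.Reachable v a) (hb : ¬ G.Reachable v b) (x : V) (h : (tog a b G).Reachable v x) :
    G.Reachable v x := by
  rw [SimpleGraph.reachable_iff_reflTransGen] at h
  induction h with
  | refl => exact SimpleGraph.Reachable.refl _
  | @tail y z hy hyz ih =>
    refine ih.trans (SimpleGraph.Adj.reachable ?_)
    have h1 : y ≠ a := by rintro rfl; exact ha ih
    have h2 : y ≠ b := by rintro rfl; exact hb ih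
    simpa [tog, symmDiff, SimpleGraph.edge_adj, h1, h2] using hyz

open Classical in
lemma sum_all {V : Type} [Fintype V] (a b : V) (hab : a ≠ b) :
    ∑ G : SimpleGraph V, (-1 : ℤ) ^ (Nat.card G.edgeSet) = 0 := by
  classical
  refine Finset.sum_involution (fun G _ => tog a b G) ?_ ?_ ?_ ?_
  · intro G _; rw [sign_tog G a b hab]; ring
  · intro G _ _ h
    have := tog_adj a b hab G
    rw [h] at this; tauto
  · intros; exact Finset.mem_univ _
  · intro G _; exact tog_tog a b G

open Classical in
/-- Signed sum over graphs with prescribed component of `v`. -/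
noncomputable def comps {V : Type} [Fintype V] (v : V) (S : Set V) : ℤ :=
  ∑ G : SimpleGraph V with {x | G.Reachable v x} = S, (-1 : ℤ) ^ (Nat.card G.edgeSet)

lemma comps_zero {V : Type} [Fintype V] (v : V) (S : Set V) (a b : V) (hab : a ≠ b)
    (ha : a ∉ S) (hb : b ∉ S) : comps v S = 0 := by
  classical
  unfold comps
  refine Finset.sum_involution (fun G _ => tog a b G) ?_ ?_ ?_ ?_
  · intro G _; rw [sign_tog G a b hab]; ring
  · intro G _ _ h
    have := tog_adj a b hab G
    rw [h] at this; tauto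
  · intro G hG
    simp only [Finset.mem_filter, Finset.mem_univ, true_and] at hG ⊢
    subst hG
    ext x
    exact ⟨tog_reach_aux2 G v a b ha hb x, tog_reach_aux G v a b ha hb x⟩
  · intro G _; exact tog_tog a b G

lemma comps_univ {V : Type} [Fintype V] (v : V) : comps v Set.univ = fconn V := by
  classical
  unfold comps fconn
  have key : ∀ G : SimpleGraph V, ({x | G.Reachable v x} = Set.univ) ↔ G.Connected := by
    intro G
    rw [SimpleGraph.connected_iff_exists_forall_reachable, Set.eq_univ_iff_forall]
    refine ⟨fun h => ⟨v, h⟩, fun ⟨u, hu⟩ x => (hu v).symm.trans (hu x)⟩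
  refine Finset.sum_congr ?_ fun _ _ => rfl
  ext G
  simp [← key]

lemma comps_self {V : Type} [Fintype V] (v : V) : comps v {v}ᶜ = 0 := by
  classical
  unfold comps
  refine Finset.sum_eq_zero fun G hG => ?_
  simp only [Finset.mem_filter, Finset.mem_univ, true_and] at hG
  have : v ∈ ({v}ᶜ : Set V) := by rw [← hG]; exact SimpleGraph.Reachable.refl _
  simp at this

lemma map_reach {V W : Type} (f : W ↪ V) (H : SimpleGraph W) (a : W) (y : V)
    (h : (H.map f).Reachable (f a) y) : ∃ b, f b = y ∧ H.Reachable a b := by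
  rw [SimpleGraph.reachable_iff_reflTransGen] at h
  induction h with
  | refl => exact ⟨a, rfl, SimpleGraph.Reachable.refl _⟩
  | tail hy hyz ih =>
    obtain ⟨b, rfl, hb⟩ := ih
    rw [SimpleGraph.map_adj] at hyz
    obtain ⟨u, w, huw, hu, rfl⟩ := hyz
    obtain rfl := f.injective hu
    exact ⟨w, rfl, hb.trans huw.reachable⟩

lemma comps_compl {V : Type} [Fintype V] [DecidableEq V] (v w : V) (h : v ≠ w) :
    comps v {w}ᶜ = fconn {x : V // x ≠ w} := by
  classical
  unfold comps fconn
  symm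
  set f : {x : V // x ≠ w} ↪ V := Function.Embedding.subtype _ with hf
  refine Finset.sum_bij (fun H _ => H.map f) ?_ ?_ ?_ ?_
  · intro H hH
    simp only [Finset.mem_filter, Finset.mem_univ, true_and] at hH ⊢
    ext y
    constructor
    · intro hy
      obtain ⟨b, rfl, _⟩ := map_reach f H ⟨v, h⟩ y hy
      exact b.2
    · intro hy
      exact (hH.preconnected ⟨v, h⟩ ⟨y, hy⟩).map (SimpleGraph.Embedding.map f H).toHom
  · intro H _ H' _ he
    exact SimpleGraph.map_injective f he
  · intro G hG
    simp only [Finset.mem_filter, Finset.mem_univ, true_and] at hG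
    have hr : ∀ x, G.Reachable v x ↔ x ≠ w := fun x => by
      have := Set.ext_iff.1 hG x
      simpa using this
    have hm : (G.comap f).map f = G := by
      ext x y
      rw [SimpleGraph.map_adj]
      constructor
      · rintro ⟨a, b, hab, rfl, rfl⟩; exact hab
      · intro hxy
        have hx : x ≠ w := by
          rintro rfl
          have hy : y ≠ x := hxy.ne'
          exact (hr x).1 (((hr y).2 hy).trans hxy.symm.reachable) rfl
        have hy : y ≠ w := by
          rintro rfl
          exact (hr y).1 (((hr x).2 hx).trans hxy.reachable) rfl
        exact ⟨⟨x, hx⟩, ⟨y, hy⟩, hxy, rfl, rfl⟩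
    refine ⟨G.comap f, ?_, hm⟩
    simp only [Finset.mem_filter, Finset.mem_univ, true_and]
    rw [SimpleGraph.connected_iff_exists_forall_reachable]
    refine ⟨⟨v, h⟩, fun y => ?_⟩
    have h1 := (hr y.1).2 y.2
    rw [← hm] at h1
    obtain ⟨b, hb, hb'⟩ := map_reach f _ ⟨v, h⟩ y.1 h1
    have : b = y := f.injective hb
    exact this ▸ hb'
  · intro H _
    congr 1
    rw [SimpleGraph.edgeSet_map]
    exact (Nat.card_image_of_injective f.sym2Map.injective _).symm

open Classical in
lemma fconn_rec {V : Type} [Fintype V] (v b : V) (hvb : v ≠ b) :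
    fconn V + ∑ w ∈ Finset.univ.erase v, fconn {x : V // x ≠ w} = 0 := by
  have h0 := sum_all v b hvb
  rw [← Finset.sum_fiberwise (s := Finset.univ)
    (g := fun G : SimpleGraph V => ({x | G.Reachable v x} : Set V))] at h0
  have h1 : ∑ S : Set V, comps v S = 0 := h0
  have h2 : ∑ S : Set V, comps v S =
      ∑ S ∈ insert Set.univ (Finset.univ.image fun w : V => ({w}ᶜ : Set V)), comps v S := by
    symm
    refine Finset.sum_subset (Finset.subset_univ _) fun S _ hS => ?_
    simp only [Finset.mem_insert, Finset.mem_image, Finset.mem_univ, true_and, not_or,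
      not_exists] at hS
    obtain ⟨hS1, hS2⟩ := hS
    obtain ⟨a, ha⟩ := (Set.ne_univ_iff_exists_notMem S).1 hS1
    by_contra hne
    apply hS2 a
    ext x
    constructor
    · intro hx
      by_contra hxS
      exact hne (comps_zero v S a x (fun hax => hx hax.symm) ha hxS)
    · intro hx hxa
      exact ha (hxa ▸ hx)
  rw [h2, Finset.sum_insert, Finset.sum_image, comps_univ,
    ← Finset.add_sum_erase _ _ (Finset.mem_univ v), comps_self, zero_add] at h1
  · rw [← h1]
    congr 1
    refine Finset.sum_congr rfl fun w hw => ?_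
    rw [comps_compl v w (Finset.ne_of_mem_erase hw).symm]
  · intro x _ y _ hxy
    simpa using hxy
  · simp

lemma fconn_eq (n : ℕ) : ∀ (V : Type) [Fintype V], Fintype.card V = n + 1 →
    fconn V = (-1) ^ n * (Nat.factorial n : ℤ) := by
  classical
  induction n with
  | zero =>
    intro V _ hV
    obtain ⟨v, hv⟩ := Fintype.card_eq_one_iff.1 hV
    have : Subsingleton V := ⟨fun a b => (hv a).trans (hv b).symm⟩
    have : Nonempty V := ⟨v⟩
    have hc : ∀ G : SimpleGraph V, G.Connected := fun G =>
      (SimpleGraph.connected_iff _).2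
        ⟨fun a b => by rw [Subsingleton.elim a b], inferInstance⟩
    have hu : ∀ G : SimpleGraph V, G = ⊥ := fun G => by
      ext a b; rw [Subsingleton.elim a b]; simp
    unfold fconn
    rw [Finset.sum_eq_single ⊥]
    · simp
    · intro G _ hG; exact absurd (hu G) hG
    · intro h; exact absurd (by simp [hc]) h
  | succ n ih =>
    intro V _ hV
    obtain ⟨v, b, hvb⟩ := Fintype.one_lt_card_iff.1 (show 1 < Fintype.card V by omega)
    have h := fconn_rec v b hvb
    have h2 : ∀ w ∈ Finset.univ.erase v, fconn {x : V // x ≠ w} =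
        (-1) ^ n * (Nat.factorial n : ℤ) := by
      intro w _
      apply ih
      rw [Fintype.card_subtype_compl, Fintype.card_subtype_eq]
      omega
    rw [Finset.sum_congr rfl h2, Finset.sum_const, Finset.card_erase_of_mem (Finset.mem_univ _),
      Finset.card_univ, hV] at h
    simp only [Nat.add_sub_cancel, nsmul_eq_mul] at h
    rw [Nat.factorial_succ, pow_succ]
    push_cast at h ⊢
    linarith

theorem stmt_7 (k : ℕ) (hk : 1 ≤ k) :
    ∑ e ∈ Finset.range (k.choose 2 + 1), (-1 : ℤ) ^ e * gconn e k =
      (-1) ^ (k + 1) * (Nat.factorial (k - 1) : ℤ) := by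
  classical
  obtain ⟨n, rfl⟩ : ∃ n, k = n + 1 := ⟨k - 1, by omega⟩
  have h := fconn_eq n (Fin (n + 1)) (by simp)
  rw [show (-1 : ℤ) ^ (n + 1 + 1) * (Nat.factorial (n + 1 - 1) : ℤ) =
    (-1) ^ n * (Nat.factorial n : ℤ) by simp [pow_succ], ← h]
  unfold fconn
  rw [← Finset.sum_fiberwise_of_maps_to
    (t := Finset.range ((n + 1).choose 2 + 1))
    (g := fun G : SimpleGraph (Fin (n + 1)) => Nat.card G.edgeSet)]
  · refine Finset.sum_congr rfl fun e _ => ?_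
    rw [Finset.sum_congr rfl (g := fun _ => (-1 : ℤ) ^ e), Finset.sum_const, gconn,
      Finset.filter_filter, Nat.card_eq_fintype_card, Fintype.card_subtype, nsmul_eq_mul, mul_comm]
    · congr!
    intro G hG
    rw [(Finset.mem_filter.1 hG).2]
  · intro G _
    have := G.card_edgeFinset_le_card_choose_two
    rw [Fintype.card_fin] at this
    have h2 : Nat.card G.edgeSet = G.edgeFinset.card := by
      simp only [← SimpleGraph.coe_edgeFinset, Nat.card_eq_card_toFinset, Finset.toFinset_coe]
    simp only [Finset.mem_range]
    omega
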